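/- Let Φ = (φ_{i,j}) ∈ ℝ^{m×N} and 1 ≤ K ≤ N. With D_SQ*(R) the optimal scalar distortion-rate function of the measurements of a random K-sparse Gaussian signal (defined in the context) and μ₁ := (1/N) ∑_{i=1}^m ∑_{j=1}^N φ_{i,j}², one has liminf_{R→∞} (2^{2R}/K) · D_SQ*(R) ≥ (π√3/2) · μ₁. -/

import Mathlib

open MeasureTheory ProbabilityTheory Real Filter

/-- The expected distortion `D(C)` of scalar-quantizing, with the codebook `C`, the
measurements `Y = ΦX` of a `K`-sparse signal whose support `T` is uniform over size-`K`
subsets of `{1,…,N}` and whose nonzero entries are i.i.d. standard Gaussian: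
each coordinate `Y i` given `T` is centered Gaussian with variance `σ_{i,T}² = ∑_{j∈T} φ_{i,j}²`. -/
noncomputable def measDist {m N : ℕ} (Φ : Matrix (Fin m) (Fin N) ℝ) (K : ℕ)
    (C : Finset ℝ) (hC : C.Nonempty) : ℝ :=
  (1 / (N.choose K : ℝ)) *
    ∑ T ∈ Finset.powersetCard K (Finset.univ : Finset (Fin N)), ∑ i : Fin m,
      ∫ y, C.inf' hC (fun c => (y - c) ^ 2)
        ∂(gaussianReal 0 (Real.toNNReal (∑ j ∈ T, (Φ i j) ^ 2)))

/-- The optimal scalar distortion-rate function `D_SQ*(R)` at rate `R` bits. -/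
noncomputable def DSQ {m N : ℕ} (Φ : Matrix (Fin m) (Fin N) ℝ) (K : ℕ) (R : ℕ) : ℝ :=
  sInf {d : ℝ | ∃ (C : Finset ℝ) (hC : C.Nonempty), C.card ≤ 2 ^ R ∧
    d = measDist Φ K C hC}

lemma Finset.sum_powersetCard_sum_mem {ι : Type*} [DecidableEq ι] (s : Finset ι) {k : ℕ}
    (hk : 1 ≤ k) (f : ι → ℝ) :
    ∑ t ∈ s.powersetCard k, ∑ j ∈ t, f j = (s.card - 1).choose (k - 1) * ∑ j ∈ s, f j := by
  have h₁ : ∀ t ∈ s.powersetCard k, ∑ j ∈ t, f j = ∑ j ∈ s, if j ∈ t then f j else 0 := by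
    intro t ht
    rw [← Finset.sum_filter, Finset.filter_mem_eq_inter,
      Finset.inter_eq_right.2 (Finset.mem_powersetCard.1 ht).1]
  rw [Finset.sum_congr rfl h₁, Finset.sum_comm, Finset.mul_sum]
  refine Finset.sum_congr rfl fun j hj => ?_
  rw [← Finset.sum_filter, Finset.sum_const, nsmul_eq_mul]
  congr 2
  have := Finset.card_filter_powersetCard_subset {j} s k (by simpa using hj) (by simpa using hk)
  simpa using this

lemma Nat.cast_choose_sub_one_div_choose {n k : ℕ} (hk : 1 ≤ k) (hkn : k ≤ n) :
    ((n - 1).choose (k - 1) : ℝ) / n.choose k = k / n := by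
  obtain ⟨k, rfl⟩ := Nat.exists_eq_add_of_le' hk
  obtain ⟨n, rfl⟩ := Nat.exists_eq_add_of_le' (hk.trans hkn)
  have h : ((n + 1 : ℕ) : ℝ) * n.choose k = (n + 1).choose (k + 1) * ((k + 1 : ℕ) : ℝ) := by
    exact_mod_cast Nat.add_one_mul_choose_eq n k
  have h₀ : ((n + 1).choose (k + 1) : ℝ) ≠ 0 := by
    exact_mod_cast (Nat.choose_pos hkn).ne'
  rw [div_eq_div_iff h₀ (by positivity)]
  simp only [Nat.add_sub_cancel]
  linarith

lemma inf'_sq_sub_nonneg (C : Finset ℝ) (hC : C.Nonempty) (y : ℝ) :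
    0 ≤ C.inf' hC (fun c => (y - c) ^ 2) :=
  Finset.le_inf' _ _ fun _ _ => sq_nonneg _

lemma continuous_inf'_sq_sub (C : Finset ℝ) (hC : C.Nonempty) :
    Continuous fun y => C.inf' hC (fun c => (y - c) ^ 2) :=
  Continuous.finset_inf'_apply hC fun c _ => by fun_prop

lemma integrable_sq_sub_gaussianReal (c μ : ℝ) (v : NNReal) :
    Integrable (fun y => (y - c) ^ 2) (gaussianReal μ v) :=
  ((memLp_id_gaussianReal 2).sub (memLp_const c)).integrable_sq

lemma integrable_inf'_sq_sub_gaussianReal (C : Finset ℝ) (hC : C.Nonempty) (μ : ℝ) (v : NNReal) :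
    Integrable (fun y => C.inf' hC (fun c => (y - c) ^ 2)) (gaussianReal μ v) := by
  obtain ⟨c, hc⟩ := id hC
  refine (integrable_sq_sub_gaussianReal c μ v).mono'
    (continuous_inf'_sq_sub C hC).aestronglyMeasurable (Eventually.of_forall fun y => ?_)
  rw [Real.norm_of_nonneg (inf'_sq_sub_nonneg C hC y)]
  exact Finset.inf'_le _ hc

/-- The companding codebook `t ↦ t / (1 - |t|)` on a grid of mesh `1 / n` has squared error
at most `(1 + |y|) ^ 4 / n ^ 2`. -/
lemma exists_codebook_inf'_sq_sub_le {n : ℕ} (hn : 0 < n) :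
    ∃ (C : Finset ℝ) (hC : C.Nonempty), C.card ≤ 2 * n ∧
      ∀ y, C.inf' hC (fun c => (y - c) ^ 2) ≤ (1 + |y|) ^ 4 / n ^ 2 := by
  let g : ℕ → ℝ := fun k => k / (n - k)
  have key : ∀ y : ℝ, 0 ≤ y → ∃ k ∈ Finset.range n, (y - g k) ^ 2 ≤ (1 + y) ^ 4 / n ^ 2 := by
    intro y hy
    have hn' : (0 : ℝ) < n := by exact_mod_cast hn
    have hy' : 0 < 1 + y := by linarith
    have hlow : (⌊n * y / (1 + y)⌋₊ : ℝ) ≤ n * y / (1 + y) := Nat.floor_le (by positivity)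
    have hupp := Nat.lt_floor_add_one (n * y / (1 + y) : ℝ)
    set k := ⌊n * y / (1 + y)⌋₊
    rw [le_div_iff₀ hy'] at hlow
    rw [div_lt_iff₀ hy'] at hupp
    have hnk : (n : ℝ) ≤ (n - k) * (1 + y) := by nlinarith
    have hpos : (0 : ℝ) < n - k := by
      by_contra! h
      nlinarith
    refine ⟨k, Finset.mem_range.2 (by exact_mod_cast sub_pos.1 hpos), ?_⟩
    have heq : y - g k = (n * y - k * (1 + y)) / (n - k) := by
      simp only [g]
      field_simp
      ring
    have h0 : 0 ≤ y - g k := by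
      rw [heq]
      exact div_nonneg (by linarith) hpos.le
    have h1 : y - g k ≤ (1 + y) ^ 2 / n := by
      rw [heq, div_le_div_iff₀ hpos hn']
      have : n * y - k * (1 + y) ≤ 1 + y := by nlinarith
      calc (n * y - k * (1 + y)) * n ≤ (1 + y) * ((n - k) * (1 + y)) := by
            apply mul_le_mul this hnk hn'.le hy'.le
        _ = _ := by ring
    calc (y - g k) ^ 2 ≤ ((1 + y) ^ 2 / n) ^ 2 := pow_le_pow_left₀ h0 h1 2
      _ = _ := by ring
  have hne : (Finset.range n).Nonempty := ⟨0, Finset.mem_range.2 hn⟩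
  refine ⟨(Finset.range n).image g ∪ (Finset.range n).image (fun k => -g k),
    (hne.image _).mono Finset.subset_union_left, ?_, fun y => ?_⟩
  · calc _ ≤ ((Finset.range n).image g).card + ((Finset.range n).image (fun k => -g k)).card :=
          Finset.card_union_le _ _
      _ ≤ n + n := by
          refine add_le_add ?_ ?_ <;>
          exact Finset.card_image_le.trans_eq (Finset.card_range n)
      _ = 2 * n := by ring
  · obtain ⟨k, hk, h⟩ := key |y| (abs_nonneg y)
    rcases le_total 0 y with hy | hy
    · rw [abs_of_nonneg hy] at h ⊢
      exact (Finset.inf'_le _ (Finset.mem_union_left _ (Finset.mem_image_of_mem g hk))).trans h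
    · refine (Finset.inf'_le _ (Finset.mem_union_right _ (Finset.mem_image_of_mem _ hk))).trans
        (le_trans (le_of_eq ?_) h)
      rw [abs_of_nonpos hy]
      ring

lemma integral_max_sq_sub_sq_le {A c ρ : ℝ} (hA : 0 ≤ A) (hρ : 0 ≤ ρ) :
    ∫ y in (-A)..A, max (ρ ^ 2 - (y - c) ^ 2) 0 ≤ 4 / 3 * ρ ^ 3 := by
  have hmax : (fun y => max (ρ ^ 2 - (y - c) ^ 2) 0) =
      (Set.Icc (c - ρ) (c + ρ)).indicator fun y => ρ ^ 2 - (y - c) ^ 2 := by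
    ext y
    by_cases hy : y ∈ Set.Icc (c - ρ) (c + ρ)
    · rw [Set.indicator_of_mem hy, max_eq_left]
      nlinarith [hy.1, hy.2]
    · rw [Set.indicator_of_notMem hy, max_eq_right]
      rw [sub_nonpos, sq_le_sq, abs_of_nonneg hρ]
      by_contra! h
      rw [abs_lt] at h
      exact hy ⟨by linarith, by linarith⟩
  have hint : IntegrableOn (fun y => ρ ^ 2 - (y - c) ^ 2) (Set.Icc (c - ρ) (c + ρ)) :=
    Continuous.integrableOn_Icc (by fun_prop)
  rw [intervalIntegral.integral_of_le (by linarith)]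
  calc ∫ y in Set.Ioc (-A) A, max (ρ ^ 2 - (y - c) ^ 2) 0
      ≤ ∫ y, max (ρ ^ 2 - (y - c) ^ 2) 0 := by
        refine setIntegral_le_integral ?_ (Eventually.of_forall fun y => le_max_right _ _)
        rw [hmax]
        exact hint.integrable_indicator measurableSet_Icc
    _ = ∫ y in (c - ρ)..(c + ρ), (ρ ^ 2 - (y - c) ^ 2) := by
        rw [hmax, integral_indicator measurableSet_Icc, integral_Icc_eq_integral_Ioc,
          intervalIntegral.integral_of_le (by linarith)]
    _ = 4 / 3 * ρ ^ 3 := by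
        rw [intervalIntegral.integral_comp_sub_right (fun y => ρ ^ 2 - y ^ 2) c,
          intervalIntegral.integral_sub (by simp) (by simp)]
        simp
        ring

/-- Comparison of the weights `exp (-y ^ 2 / 6)` at two nearby points of `[-A, A]`. -/
lemma exp_neg_sq_div_six_le {A δ y z : ℝ} (hy : |y| ≤ A) (hz : |z| ≤ A) (hyz : |y - z| ≤ δ) :
    exp (-y ^ 2 / 6) ≤ exp (A * δ) * exp (-z ^ 2 / 6) := by
  rw [← exp_add, exp_le_exp]
  have hA : 0 ≤ A := (abs_nonneg y).trans hy
  have h : (z - y) * (z + y) ≤ δ * (2 * A) := by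
    refine (le_abs_self _).trans ?_
    rw [abs_mul, abs_sub_comm]
    refine mul_le_mul hyz ((abs_add_le _ _).trans (by linarith)) (abs_nonneg _)
      ((abs_nonneg _).trans hyz)
  have : 0 ≤ δ * A := mul_nonneg ((abs_nonneg _).trans hyz) hA
  nlinarith

/-- With `h y = exp (-y ^ 2 / 6)`, the mass of the weighted parabolic bump of local radius
`κ / h` around `c` is asymptotically at most `4 / 3 * κ ^ 3` as `κ → 0`. -/
lemma integral_bump_le {A κ : ℝ} (c : ℝ) (hA : 0 ≤ A) (hκ : 0 ≤ κ) :
    ∫ y in (-A)..A, max (κ ^ 2 * exp (-y ^ 2 / 6) - (y - c) ^ 2 * exp (-y ^ 2 / 6) ^ 3) 0 ≤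
      4 / 3 * κ ^ 3 * exp (A * (κ * exp (A ^ 2 / 6))) ^ 6 := by
  obtain ⟨z, hz, hzc⟩ : ∃ z : ℝ, |z| ≤ A ∧ ∀ y, |y| ≤ A → (y - z) ^ 2 ≤ (y - c) ^ 2 := by
    refine ⟨max (-A) (min A c), abs_le.2 ⟨le_max_left _ _, max_le (by linarith) (min_le_left _ _)⟩,
      fun y hy => ?_⟩
    rw [abs_le] at hy
    rcases le_total A c with h | h
    · rw [min_eq_left h, max_eq_right (by linarith)]
      nlinarith
    · rw [min_eq_right h]
      rcases le_total (-A) c with h' | h'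
      · rw [max_eq_right h']
      · rw [max_eq_left h']
        nlinarith
  set δ := κ * exp (A ^ 2 / 6) with hδ
  have hδ0 : 0 ≤ δ := by positivity
  set E := exp (A * δ) with hE
  set w := exp (-z ^ 2 / 6) with hw
  have hw0 : 0 < w := exp_pos _
  have hE0 : 0 < E := exp_pos _
  have hpt : ∀ y ∈ Set.Icc (-A) A,
      max (κ ^ 2 * exp (-y ^ 2 / 6) - (y - c) ^ 2 * exp (-y ^ 2 / 6) ^ 3) 0 ≤
        (E * w) ^ 3 * max ((κ * E / w) ^ 2 - (y - z) ^ 2) 0 := by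
    intro y hy
    have hy : |y| ≤ A := abs_le.2 hy
    set u := exp (-y ^ 2 / 6) with hu
    have hu0 : 0 < u := exp_pos _
    have hfac : κ ^ 2 * u - (y - c) ^ 2 * u ^ 3 = u ^ 3 * ((κ / u) ^ 2 - (y - c) ^ 2) := by
      field_simp
    refine max_le ?_ (mul_nonneg (by positivity) (le_max_right _ _))
    rcases le_or_gt (κ / u) |y - z| with h | h
    · refine le_trans ?_ (mul_nonneg (by positivity) (le_max_right _ _))
      rw [hfac]
      refine mul_nonpos_of_nonneg_of_nonpos (by positivity) ?_
      have : (κ / u) ^ 2 ≤ (y - z) ^ 2 := by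
        rw [← sq_abs (y - z)]
        exact pow_le_pow_left₀ (by positivity) h 2
      linarith [hzc y hy]
    · have hyz : |y - z| ≤ δ := by
        refine h.le.trans ?_
        rw [div_eq_mul_inv, hδ, hu, ← exp_neg]
        gcongr
        have := sq_le_sq' (by linarith [abs_nonneg y]) hy
        rw [sq_abs] at this
        linarith
      have huw : u ≤ E * w := exp_neg_sq_div_six_le hy hz hyz
      have hwu : w ≤ E * u := exp_neg_sq_div_six_le hz hy (by rwa [abs_sub_comm])
      have hr : κ / u ≤ κ * E / w := by
        rw [div_le_div_iff₀ hu0 hw0, mul_assoc]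
        gcongr
      rw [hfac]
      calc u ^ 3 * ((κ / u) ^ 2 - (y - c) ^ 2)
          ≤ u ^ 3 * max ((κ * E / w) ^ 2 - (y - z) ^ 2) 0 := by
            refine mul_le_mul_of_nonneg_left (le_max_of_le_left ?_) (by positivity)
            have := pow_le_pow_left₀ (by positivity) hr 2
            linarith [hzc y hy]
        _ ≤ _ := mul_le_mul_of_nonneg_right (pow_le_pow_left₀ hu0.le huw 3) (le_max_right _ _)
  calc _ ≤ ∫ y in (-A)..A, (E * w) ^ 3 * max ((κ * E / w) ^ 2 - (y - z) ^ 2) 0 := by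
        refine intervalIntegral.integral_mono_on (by linarith) ?_ ?_ hpt <;>
        exact Continuous.intervalIntegrable (by fun_prop) _ _
    _ ≤ (E * w) ^ 3 * (4 / 3 * (κ * E / w) ^ 3) := by
        rw [intervalIntegral.integral_const_mul]
        gcongr
        exact integral_max_sq_sub_sq_le hA (by positivity)
    _ = 4 / 3 * κ ^ 3 * E ^ 6 := by
        field_simp

lemma gaussianPDFReal_zero_one (y : ℝ) :
    gaussianPDFReal 0 1 y = (√(2 * π))⁻¹ * exp (-y ^ 2 / 6) ^ 3 := by
  rw [gaussianPDFReal_def, ← exp_nat_mul]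
  simp only [NNReal.coe_one, mul_one, sub_zero]
  congr 2
  push_cast
  ring

lemma le_integral_inf'_sq_sub_gaussianReal (C : Finset ℝ) (hC : C.Nonempty) {A κ : ℝ}
    (hA : 0 ≤ A) (hκ : 0 ≤ κ) :
    (√(2 * π))⁻¹ * (κ ^ 2 * (∫ y in (-A)..A, exp (-y ^ 2 / 6)) -
        C.card * (4 / 3 * κ ^ 3 * exp (A * (κ * exp (A ^ 2 / 6))) ^ 6)) ≤
      ∫ y, C.inf' hC (fun c => (y - c) ^ 2) ∂gaussianReal 0 1 := by
  have hcont := continuous_inf'_sq_sub C hC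
  have hpt : ∀ y, κ ^ 2 * exp (-y ^ 2 / 6) -
      ∑ c ∈ C, max (κ ^ 2 * exp (-y ^ 2 / 6) - (y - c) ^ 2 * exp (-y ^ 2 / 6) ^ 3) 0 ≤
        exp (-y ^ 2 / 6) ^ 3 * C.inf' hC (fun c => (y - c) ^ 2) := by
    intro y
    obtain ⟨c, hc, h⟩ := C.exists_mem_eq_inf' hC (fun c => (y - c) ^ 2)
    rw [h]
    have := Finset.single_le_sum (f := fun c =>
      max (κ ^ 2 * exp (-y ^ 2 / 6) - (y - c) ^ 2 * exp (-y ^ 2 / 6) ^ 3) 0)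
      (fun _ _ => le_max_right _ _) hc
    have h' := (le_max_left _ _).trans this
    linarith
  have hbump : ∀ c, IntervalIntegrable (fun y : ℝ =>
      max (κ ^ 2 * exp (-y ^ 2 / 6) - (y - c) ^ 2 * exp (-y ^ 2 / 6) ^ 3) 0) volume (-A) A :=
    fun c => Continuous.intervalIntegrable (by fun_prop) _ _
  have hsum : IntervalIntegrable (fun y : ℝ => ∑ c ∈ C,
      max (κ ^ 2 * exp (-y ^ 2 / 6) - (y - c) ^ 2 * exp (-y ^ 2 / 6) ^ 3) 0) volume (-A) A :=
    Continuous.intervalIntegrable (by fun_prop) _ _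
  have hgauss : IntervalIntegrable (fun y : ℝ => κ ^ 2 * exp (-y ^ 2 / 6)) volume (-A) A :=
    Continuous.intervalIntegrable (by fun_prop) _ _
  have hint : Integrable (fun y => exp (-y ^ 2 / 6) ^ 3 * C.inf' hC (fun c => (y - c) ^ 2)) := by
    have h := integrable_inf'_sq_sub_gaussianReal C hC 0 1
    rw [gaussianReal_of_var_ne_zero _ one_ne_zero,
      integrable_withDensity_iff_integrable_smul' (measurable_gaussianPDF 0 1)
        (Eventually.of_forall fun _ => gaussianPDF_lt_top)] at h
    refine (h.const_mul (√(2 * π))).congr (Eventually.of_forall fun y => ?_)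
    simp only [toReal_gaussianPDF, gaussianPDFReal_zero_one, smul_eq_mul]
    field_simp
  rw [integral_gaussianReal_eq_integral_smul one_ne_zero]
  simp only [gaussianPDFReal_zero_one, smul_eq_mul, mul_assoc]
  rw [integral_const_mul]
  refine mul_le_mul_of_nonneg_left ?_ (by positivity)
  calc _ ≤ ∫ y in (-A)..A, (κ ^ 2 * exp (-y ^ 2 / 6) -
        ∑ c ∈ C, max (κ ^ 2 * exp (-y ^ 2 / 6) - (y - c) ^ 2 * exp (-y ^ 2 / 6) ^ 3) 0) := by
        rw [intervalIntegral.integral_sub hgauss hsum,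
          intervalIntegral.integral_const_mul,
          intervalIntegral.integral_finsetSum fun c _ => hbump c]
        refine sub_le_sub_left ?_ _
        rw [← nsmul_eq_mul]
        refine Finset.sum_le_card_nsmul _ _ _ fun c _ => ?_
        simpa only [mul_assoc] using integral_bump_le c hA hκ
    _ ≤ ∫ y in (-A)..A, exp (-y ^ 2 / 6) ^ 3 * C.inf' hC (fun c => (y - c) ^ 2) := by
        refine intervalIntegral.integral_mono_on (by linarith) ?_ ?_ fun y _ => hpt y
        · exact Continuous.intervalIntegrable (by fun_prop) _ _
        · exact Continuous.intervalIntegrable (by fun_prop) _ _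
    _ ≤ _ := by
        rw [intervalIntegral.integral_of_le (by linarith)]
        exact setIntegral_le_integral hint (Eventually.of_forall fun y =>
          mul_nonneg (by positivity) (inf'_sq_sub_nonneg C hC y))

lemma tendsto_integral_exp_neg_sq_div_six :
    Tendsto (fun A : ℝ => ∫ y in (-A)..A, exp (-y ^ 2 / 6)) atTop (nhds √(6 * π)) := by
  have h : ∀ y : ℝ, exp (-y ^ 2 / 6) = exp (-(1 / 6) * y ^ 2) := fun y => by ring_nf
  have hI : ∫ y : ℝ, exp (-(1 / 6) * y ^ 2) = √(6 * π) := by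
    rw [integral_gaussian]
    congr 1
    ring
  simp only [h]
  rw [← hI]
  exact intervalIntegral_tendsto_integral (integrable_exp_neg_mul_sq (by norm_num))
    tendsto_neg_atTop_atBot tendsto_id

/-- The one-dimensional Zador lower bound for the standard Gaussian distribution. -/
lemma eventually_le_integral_inf'_sq_sub_gaussianReal {L : ℝ} (hL : L < π * √3 / 2) :
    ∀ᶠ n : ℕ in atTop, ∀ (C : Finset ℝ) (hC : C.Nonempty), C.card ≤ n →
      L / n ^ 2 ≤ ∫ y, C.inf' hC (fun c => (y - c) ^ 2) ∂gaussianReal 0 1 := by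
  set J := √(6 * π) with hJ
  have hJ0 : 0 < J := by positivity
  have hconst : (√(2 * π))⁻¹ * ((J / 2) ^ 2 * J - 4 / 3 * (J / 2) ^ 3) = π * √3 / 2 := by
    have h1 : J = √3 * √(2 * π) := by
      rw [hJ, ← sqrt_mul (by norm_num)]
      congr 1
      ring
    have h2 : √(2 * π) ^ 2 = 2 * π := sq_sqrt (by positivity)
    have h3 : √(2 * π) ≠ 0 := by positivity
    have h4 : √3 ^ 2 = 3 := sq_sqrt (by norm_num)
    calc _ = √3 * √3 ^ 2 * √(2 * π) ^ 2 / 12 := by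
          rw [h1]
          field_simp
          ring
      _ = _ := by rw [h2, h4]; ring
  have hlimA : Tendsto (fun A : ℝ => (√(2 * π))⁻¹ *
      ((J / 2) ^ 2 * (∫ y in (-A)..A, exp (-y ^ 2 / 6)) - 4 / 3 * (J / 2) ^ 3)) atTop
      (nhds (π * √3 / 2)) := by
    rw [← hconst]
    exact ((tendsto_integral_exp_neg_sq_div_six.const_mul _).sub_const _).const_mul _
  obtain ⟨A, hAL, hA⟩ := ((hlimA.eventually_const_lt hL).and (eventually_ge_atTop 0)).exists
  set I := ∫ y in (-A)..A, exp (-y ^ 2 / 6) with hI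
  have hlimn : Tendsto (fun n : ℕ => (√(2 * π))⁻¹ * ((J / 2) ^ 2 * I -
      4 / 3 * (J / 2) ^ 3 * exp (A * (J / 2 / n * exp (A ^ 2 / 6))) ^ 6)) atTop
      (nhds ((√(2 * π))⁻¹ * ((J / 2) ^ 2 * I - 4 / 3 * (J / 2) ^ 3))) := by
    have h0 := tendsto_const_div_atTop_nhds_zero_nat (J / 2)
    have hE : Tendsto (fun n : ℕ => exp (A * (J / 2 / n * exp (A ^ 2 / 6))) ^ 6) atTop
        (nhds 1) := by
      have hc : Continuous fun x : ℝ => exp (A * (x * exp (A ^ 2 / 6))) ^ 6 := by fun_prop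
      simpa [Function.comp_def] using (hc.tendsto 0).comp h0
    simpa using ((hE.const_mul (4 / 3 * (J / 2) ^ 3)).const_sub ((J / 2) ^ 2 * I)).const_mul
      (√(2 * π))⁻¹
  filter_upwards [hlimn.eventually_const_lt hAL, eventually_gt_atTop 0] with n hn hn0 C hC hCn
  have hn0' : (0 : ℝ) < n := by exact_mod_cast hn0
  refine le_trans ?_ (le_integral_inf'_sq_sub_gaussianReal C hC hA
    (show 0 ≤ J / 2 / n by positivity))
  rw [div_le_iff₀ (by positivity)]
  refine hn.le.trans ?_
  refine (mul_le_mul_of_nonneg_left ?_ (inv_nonneg.2 (sqrt_nonneg (2 * π)))).trans_eq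
    (mul_assoc _ _ _).symm
  rw [← hI]
  set E := exp (A * (J / 2 / n * exp (A ^ 2 / 6))) ^ 6
  have hE : 0 < E := by positivity
  calc (J / 2) ^ 2 * I - 4 / 3 * (J / 2) ^ 3 * E
      = ((J / 2 / n) ^ 2 * I - n * (4 / 3 * (J / 2 / n) ^ 3 * E)) * n ^ 2 := by
        field_simp
    _ ≤ _ := by gcongr

lemma mul_le_integral_inf'_sq_sub_gaussianReal {n : ℕ} {b s : ℝ} (hs : 0 ≤ s)
    (h : ∀ (C : Finset ℝ) (hC : C.Nonempty), C.card ≤ n →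
      b ≤ ∫ y, C.inf' hC (fun c => (y - c) ^ 2) ∂gaussianReal 0 1)
    (C : Finset ℝ) (hC : C.Nonempty) (hCn : C.card ≤ n) :
    s * b ≤ ∫ y, C.inf' hC (fun c => (y - c) ^ 2) ∂gaussianReal 0 s.toNNReal := by
  rcases hs.eq_or_lt with rfl | hs
  · rw [zero_mul]
    exact integral_nonneg fun y => inf'_sq_sub_nonneg C hC y
  have hr : 0 < √s := sqrt_pos.2 hs
  have hmap : gaussianReal 0 s.toNNReal = (gaussianReal 0 1).map (√s * ·) := by
    rw [gaussianReal_map_const_mul, mul_zero, mul_one]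
    congr 1
    ext
    simp [hs.le]
  rw [hmap, integral_map (by fun_prop) (continuous_inf'_sq_sub C hC).aestronglyMeasurable]
  have hscale : ∀ y, s * (C.image (· / √s)).inf' (hC.image _) (fun c => (y - c) ^ 2) ≤
      C.inf' hC (fun c => (√s * y - c) ^ 2) := by
    intro y
    refine Finset.le_inf' _ _ fun c hc => ?_
    calc _ ≤ s * (y - c / √s) ^ 2 :=
          mul_le_mul_of_nonneg_left (Finset.inf'_le _ (Finset.mem_image_of_mem _ hc)) hs.le
      _ = (√s * (y - c / √s)) ^ 2 := by rw [mul_pow, sq_sqrt hs.le]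
      _ = _ := by rw [mul_sub, mul_div_cancel₀ _ hr.ne']
  calc s * b ≤ s * ∫ y, (C.image (· / √s)).inf' (hC.image _) (fun c => (y - c) ^ 2)
        ∂gaussianReal 0 1 :=
        mul_le_mul_of_nonneg_left (h _ _ (Finset.card_image_le.trans hCn)) hs.le
    _ ≤ _ := by
        rw [← integral_const_mul]
        refine integral_mono ((integrable_inf'_sq_sub_gaussianReal _ _ 0 1).const_mul s) ?_ hscale
        have h := integrable_inf'_sq_sub_gaussianReal C hC 0 s.toNNReal
        rw [hmap, integrable_map_measure (continuous_inf'_sq_sub C hC).aestronglyMeasurable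
          (by fun_prop)] at h
        exact h

lemma measDist_nonneg {m N : ℕ} (Φ : Matrix (Fin m) (Fin N) ℝ) (K : ℕ)
    (C : Finset ℝ) (hC : C.Nonempty) : 0 ≤ measDist Φ K C hC :=
  mul_nonneg (by positivity) (Finset.sum_nonneg fun _ _ => Finset.sum_nonneg fun _ _ =>
    integral_nonneg fun y => inf'_sq_sub_nonneg C hC y)

lemma bddBelow_measDist {m N : ℕ} (Φ : Matrix (Fin m) (Fin N) ℝ) (K R : ℕ) :
    BddBelow {d : ℝ | ∃ (C : Finset ℝ) (hC : C.Nonempty), C.card ≤ 2 ^ R ∧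
      d = measDist Φ K C hC} :=
  ⟨0, by rintro _ ⟨C, hC, -, rfl⟩; exact measDist_nonneg Φ K C hC⟩

lemma le_measDist {m N K n : ℕ} (Φ : Matrix (Fin m) (Fin N) ℝ) (hK1 : 1 ≤ K) (hKN : K ≤ N)
    {b : ℝ} (h : ∀ (C : Finset ℝ) (hC : C.Nonempty), C.card ≤ n →
      b ≤ ∫ y, C.inf' hC (fun c => (y - c) ^ 2) ∂gaussianReal 0 1)
    (C : Finset ℝ) (hC : C.Nonempty) (hCn : C.card ≤ n) :
    K * b * (1 / N * ∑ i, ∑ j, Φ i j ^ 2) ≤ measDist Φ K C hC := by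
  calc K * b * (1 / N * ∑ i, ∑ j, Φ i j ^ 2)
      = (1 / (N.choose K : ℝ)) * ∑ T ∈ Finset.powersetCard K (Finset.univ : Finset (Fin N)),
          ∑ i, (∑ j ∈ T, Φ i j ^ 2) * b := by
        have hsum : ∑ T ∈ Finset.powersetCard K (Finset.univ : Finset (Fin N)),
            ∑ i, (∑ j ∈ T, Φ i j ^ 2) * b =
              (N - 1).choose (K - 1) * (∑ i, ∑ j, Φ i j ^ 2) * b := by
          rw [Finset.sum_comm]
          simp_rw [← Finset.sum_mul, Finset.sum_powersetCard_sum_mem _ hK1, ← Finset.mul_sum,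
            Finset.card_univ, Fintype.card_fin]
        have hquot := Nat.cast_choose_sub_one_div_choose hK1 hKN
        calc _ = K / N * ((∑ i, ∑ j, Φ i j ^ 2) * b) := by ring
          _ = _ := by
            rw [hsum, ← hquot]
            ring
    _ ≤ _ := by
        refine mul_le_mul_of_nonneg_left ?_ (by positivity)
        refine Finset.sum_le_sum fun T _ => Finset.sum_le_sum fun i _ => ?_
        exact mul_le_integral_inf'_sq_sub_gaussianReal (Finset.sum_nonneg fun _ _ => sq_nonneg _)
          h C hC hCn

lemma le_DSQ {m N K R : ℕ} (Φ : Matrix (Fin m) (Fin N) ℝ) (hK1 : 1 ≤ K) (hKN : K ≤ N)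
    {b : ℝ} (h : ∀ (C : Finset ℝ) (hC : C.Nonempty), C.card ≤ 2 ^ R →
      b ≤ ∫ y, C.inf' hC (fun c => (y - c) ^ 2) ∂gaussianReal 0 1) :
    K * b * (1 / N * ∑ i, ∑ j, Φ i j ^ 2) ≤ DSQ Φ K R := by
  refine le_csInf ⟨_, {0}, Finset.singleton_nonempty 0, ?_, rfl⟩ ?_
  · simpa using Nat.one_le_two_pow
  · rintro _ ⟨C, hC, hCn, rfl⟩
    exact le_measDist Φ hK1 hKN h C hC hCn

lemma integrable_one_add_abs_pow_gaussianReal (k : ℕ) (μ : ℝ) (v : NNReal) :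
    Integrable (fun y => (1 + |y|) ^ k) (gaussianReal μ v) := by
  have h₁ : MemLp (fun y : ℝ => |y|) k (gaussianReal μ v) :=
    (memLp_id_gaussianReal' (k : ENNReal) (ENNReal.natCast_ne_top k)).norm
  have h₂ : MemLp (fun y : ℝ => 1 + |y|) k (gaussianReal μ v) := (memLp_const (1 : ℝ)).add h₁
  refine h₂.integrable_norm_pow'.congr (Eventually.of_forall fun y => ?_)
  simp only [Real.norm_eq_abs]
  rw [abs_of_nonneg (by positivity)]

lemma exists_DSQ_succ_le {m N : ℕ} (Φ : Matrix (Fin m) (Fin N) ℝ) (K : ℕ) :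
    ∃ B : ℝ, ∀ R : ℕ, DSQ Φ K (R + 1) ≤ B / 2 ^ (2 * R) := by
  refine ⟨(1 / (N.choose K : ℝ)) * ∑ T ∈ Finset.powersetCard K (Finset.univ : Finset (Fin N)),
    ∑ i, ∫ y, (1 + |y|) ^ 4 ∂gaussianReal 0 (∑ j ∈ T, Φ i j ^ 2).toNNReal, fun R => ?_⟩
  obtain ⟨C, hC, hcard, hle⟩ := exists_codebook_inf'_sq_sub_le (n := 2 ^ R) (by positivity)
  refine (csInf_le (bddBelow_measDist Φ K (R + 1)) ⟨C, hC, ?_, rfl⟩).trans ?_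
  · rwa [pow_succ']
  rw [measDist, mul_div_assoc]
  simp_rw [Finset.sum_div]
  refine mul_le_mul_of_nonneg_left ?_ (by positivity)
  refine Finset.sum_le_sum fun T _ => Finset.sum_le_sum fun i _ => ?_
  rw [← integral_div]
  refine integral_mono (integrable_inf'_sq_sub_gaussianReal C hC _ _) 
    ((integrable_one_add_abs_pow_gaussianReal 4 _ _).div_const _)
    fun y => ?_
  refine (hle y).trans_eq ?_
  push_cast
  rw [← pow_mul, mul_comm R 2]

/-- Theorem 2, lower bound of equation (11):
`liminf_{R→∞} (2^{2R}/K) D_SQ*(R) ≥ (π√3/2) μ₁` with `μ₁ = (1/N) ∑_{i,j} φ_{i,j}²`. -/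
theorem stmt2 {m N K : ℕ} (Φ : Matrix (Fin m) (Fin N) ℝ) (hK1 : 1 ≤ K) (hKN : K ≤ N) :
    π * Real.sqrt 3 / 2 * ((1 / (N : ℝ)) * ∑ i : Fin m, ∑ j : Fin N, (Φ i j) ^ 2) ≤
      Filter.liminf (fun R : ℕ => (2 : ℝ) ^ (2 * R) / (K : ℝ) * DSQ Φ K R) Filter.atTop := by
  have hK0 : (0 : ℝ) < K := by exact_mod_cast hK1
  set μ₁ := (1 / (N : ℝ)) * ∑ i : Fin m, ∑ j : Fin N, (Φ i j) ^ 2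
  have hcob : IsCoboundedUnder (· ≥ ·) atTop
      (fun R : ℕ => (2 : ℝ) ^ (2 * R) / (K : ℝ) * DSQ Φ K R) := by
    obtain ⟨B, hB⟩ := exists_DSQ_succ_le Φ K
    refine IsBoundedUnder.isCoboundedUnder_ge ⟨4 / K * B, ?_⟩
    rw [eventually_map]
    filter_upwards [eventually_ge_atTop 1] with R hR
    obtain ⟨R, rfl⟩ := Nat.exists_eq_add_of_le' hR
    calc _ ≤ (2 : ℝ) ^ (2 * (R + 1)) / K * (B / 2 ^ (2 * R)) := by
          gcongr
          exact hB R
      _ = _ := by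
          rw [mul_add, pow_add]
          field_simp
          ring
  have hlow : ∀ L < π * √3 / 2,
      L * μ₁ ≤ liminf (fun R : ℕ => (2 : ℝ) ^ (2 * R) / (K : ℝ) * DSQ Φ K R) atTop := by
    intro L hL
    refine le_liminf_of_le hcob ?_
    filter_upwards [(tendsto_pow_atTop_atTop_of_one_lt (one_lt_two : 1 < 2)).eventually
      (eventually_le_integral_inf'_sq_sub_gaussianReal hL)] with R hR
    calc L * μ₁ = (2 : ℝ) ^ (2 * R) / K * (K * (L / ((2 ^ R : ℕ) : ℝ) ^ 2) * μ₁) := by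
          push_cast
          rw [← pow_mul, mul_comm R 2]
          field_simp
      _ ≤ _ := mul_le_mul_of_nonneg_left (le_DSQ Φ hK1 hKN hR) (by positivity)
  have hlim : Tendsto (fun L : ℝ => L * μ₁) (nhdsWithin (π * √3 / 2) (Set.Iio (π * √3 / 2)))
      (nhds (π * √3 / 2 * μ₁)) :=
    ((continuous_id.mul continuous_const).tendsto _).mono_left nhdsWithin_le_nhds
  exact le_of_tendsto hlim (eventually_mem_nhdsWithin.mono hlow)
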